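/- arXiv:2601.22042 — 3 statements merged into one kernel-verified Lean document; each statement's English description precedes it below -/
import Mathlib

section
/- Let X and Y be isogonal conjugate points in the interior of a nondegenerate triangle ABC in the Euclidean plane. Let M and N be the two points of the circumcircle of ABC equidistant from A and B, with M on the opposite side of line AB from C and N on the same side as C. Assume the circumradii of triangles ABX and ABY are distinct. Then N is the external homothety center and M is the internal homothety center of the circumcircle of ABX and the circumcircle of ABY. -/
open EuclideanGeometry

noncomputable section

abbrev Pt2 := EuclideanSpace ℝ (Fin 2)

theorem sin_angle_mul_norm_mul_norm_eq {V : Type*} [NormedAddCommGroup V]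
    [InnerProductSpace ℝ V] {a b : V} {q : ℝ} (hq : 0 < q)
    (hab : ‖a‖ ^ 2 * ‖b‖ ^ 2 = inner ℝ a b ^ 2 + q ^ 2) :
    Real.sin (InnerProductGeometry.angle a b) * (‖a‖ * ‖b‖) = q := by
  have h0 : 0 ≤ Real.sin (InnerProductGeometry.angle a b) * (‖a‖ * ‖b‖) :=
    mul_nonneg (InnerProductGeometry.sin_angle_nonneg a b) (by positivity)
  refine (sq_eq_sq₀ h0 hq.le).mp ?_
  rw [mul_pow, Real.sin_sq]
  linear_combination hab -
    (Real.cos (InnerProductGeometry.angle a b) * (‖a‖ * ‖b‖) + inner ℝ a b) *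
      InnerProductGeometry.cos_angle_mul_norm_mul_norm a b

/-- Two equal angles with positive sines have equal cotangents. -/
theorem inner_mul_eq_inner_mul_of_angle_eq {V : Type*} [NormedAddCommGroup V]
    [InnerProductSpace ℝ V] {a b c d : V} {q r : ℝ}
    (h : InnerProductGeometry.angle a b = InnerProductGeometry.angle c d)
    (hq : 0 < q) (hr : 0 < r)
    (hab : ‖a‖ ^ 2 * ‖b‖ ^ 2 = inner ℝ a b ^ 2 + q ^ 2)
    (hcd : ‖c‖ ^ 2 * ‖d‖ ^ 2 = inner ℝ c d ^ 2 + r ^ 2) :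
    inner ℝ a b * r = inner ℝ c d * q := by
  rw [← sin_angle_mul_norm_mul_norm_eq hq hab, ← sin_angle_mul_norm_mul_norm_eq hr hcd,
    ← InnerProductGeometry.cos_angle_mul_norm_mul_norm a b,
    ← InnerProductGeometry.cos_angle_mul_norm_mul_norm c d, h]
  ring

section Frame

variable {V : Type*} [NormedAddCommGroup V] [InnerProductSpace ℝ V] {u v : V}

theorem inner_smul_add_smul_of_orthogonal (huv : inner ℝ u v = 0) (hn : ‖v‖ = ‖u‖)
    (p q r s : ℝ) :
    inner ℝ (p • u + q • v) (r • u + s • v) = ‖u‖ ^ 2 * (p * r + q * s) := by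
  have hvu : inner ℝ v u = 0 := by rw [real_inner_comm, huv]
  simp only [inner_add_left, inner_add_right, real_inner_smul_left, real_inner_smul_right,
    huv, hvu, real_inner_self_eq_norm_sq, hn]
  ring

theorem norm_smul_add_smul_sq_of_orthogonal (huv : inner ℝ u v = 0) (hn : ‖v‖ = ‖u‖)
    (p q : ℝ) : ‖p • u + q • v‖ ^ 2 = ‖u‖ ^ 2 * (p ^ 2 + q ^ 2) := by
  rw [← real_inner_self_eq_norm_sq, inner_smul_add_smul_of_orthogonal huv hn]
  ring

theorem dist_sq_of_orthogonal (huv : inner ℝ u v = 0) (hn : ‖v‖ = ‖u‖)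
    {A P Q : V} {p q r s : ℝ} (hP : P - A = p • u + q • v) (hQ : Q - A = r • u + s • v) :
    dist P Q ^ 2 = ‖u‖ ^ 2 * ((p - r) ^ 2 + (q - s) ^ 2) := by
  have h : P - Q = (p - r) • u + (q - s) • v := by
    rw [← sub_sub_sub_cancel_right P Q A, hP, hQ]
    module
  rw [dist_eq_norm, h, norm_smul_add_smul_sq_of_orthogonal huv hn]

/-- Equality of angles in orthogonal coordinates, where `κ` and `μ` are the absolute values of
the cross products. -/
theorem dot_mul_cross_eq_of_angle_eq (huv : inner ℝ u v = 0) (hn : ‖v‖ = ‖u‖) (hu : u ≠ 0)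
    {p₁ q₁ p₂ q₂ p₃ q₃ p₄ q₄ κ μ : ℝ} {a b c d : V}
    (ha : a = p₁ • u + q₁ • v) (hb : b = p₂ • u + q₂ • v)
    (hc : c = p₃ • u + q₃ • v) (hd : d = p₄ • u + q₄ • v)
    (h : InnerProductGeometry.angle a b = InnerProductGeometry.angle c d)
    (hκ : 0 < κ) (hμ : 0 < μ) (hκ' : κ ^ 2 = (p₁ * q₂ - q₁ * p₂) ^ 2)
    (hμ' : μ ^ 2 = (p₃ * q₄ - q₃ * p₄) ^ 2) :
    (p₁ * p₂ + q₁ * q₂) * μ = (p₃ * p₄ + q₃ * q₄) * κ := by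
  subst ha hb hc hd
  have hL : 0 < ‖u‖ ^ 2 := by positivity
  have key := inner_mul_eq_inner_mul_of_angle_eq h (mul_pos hL hκ) (mul_pos hL hμ)
    (by
      simp only [norm_smul_add_smul_sq_of_orthogonal huv hn,
        inner_smul_add_smul_of_orthogonal huv hn]
      linear_combination (-(‖u‖ ^ 4)) * hκ')
    (by
      simp only [norm_smul_add_smul_sq_of_orthogonal huv hn,
        inner_smul_add_smul_of_orthogonal huv hn]
      linear_combination (-(‖u‖ ^ 4)) * hμ')
  simp only [inner_smul_add_smul_of_orthogonal huv hn] at key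
  have hL' : ‖u‖ ^ 2 * ‖u‖ ^ 2 ≠ 0 := by positivity
  refine mul_left_cancel₀ hL' ?_
  linear_combination key

/-- The second coordinates, relative to `A`, `u`, `v`, of two points weakly on the same side of
the line through `A` with direction `u` have nonnegative product. -/
theorem AffineSubspace.WSameSide.mul_nonneg_of_orthogonal (huv : inner ℝ u v = 0) (hn : ‖v‖ = ‖u‖)
    (hu : u ≠ 0) {A B P Q : V} (hB : B - A = u) {p q r s : ℝ}
    (hP : P - A = p • u + q • v) (hQ : Q - A = r • u + s • v)
    (h : (affineSpan ℝ ({A, B} : Set V)).WSameSide P Q) : 0 ≤ q * s := by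
  obtain ⟨a, ha, b, hb, hray⟩ := h
  have hL : 0 < ‖u‖ ^ 2 := by positivity
  have hline : ∀ z ∈ affineSpan ℝ ({A, B} : Set V), inner ℝ v (z - A) = 0 := by
    intro z hz
    obtain ⟨t, rfl⟩ := mem_affineSpan_pair_iff_exists_lineMap_eq.mp hz
    simp [AffineMap.lineMap_apply, hB, real_inner_smul_right, real_inner_comm, huv]
  have hcoord : ∀ {Z z : V} {p q : ℝ}, Z - A = p • u + q • v →
      z ∈ affineSpan ℝ ({A, B} : Set V) → inner ℝ v (Z - z) = ‖u‖ ^ 2 * q := by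
    intro Z z p q hZ hz
    have hvu : inner ℝ v u = 0 := by rw [real_inner_comm, huv]
    rw [← sub_sub_sub_cancel_right Z z A, inner_sub_right, hline z hz, hZ, inner_add_right,
      real_inner_smul_right, real_inner_smul_right, hvu, real_inner_self_eq_norm_sq, hn]
    ring
  have key := hray.map (innerₗ V v)
  simp only [vsub_eq_sub, innerₗ_apply_apply, hcoord hP ha, hcoord hQ hb] at key
  obtain h0 | h0 | ⟨r₁, r₂, h₁, h₂, h0⟩ := key
  · rcases mul_eq_zero.mp h0 with h0 | h0
    · exact absurd h0 hL.ne'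
    · simp [h0]
  · rcases mul_eq_zero.mp h0 with h0 | h0
    · exact absurd h0 hL.ne'
    · simp [h0]
  · simp only [smul_eq_mul] at h0
    have h0' : r₁ * q = r₂ * s := mul_left_cancel₀ hL.ne' (by linear_combination h0)
    have : 0 ≤ r₁ * (q * s) := by
      have : r₁ * (q * s) = r₂ * s ^ 2 := by linear_combination s * h0'
      rw [this]
      positivity
    exact nonneg_of_mul_nonneg_right this h₁

theorem AffineSubspace.WOppSide.mul_nonpos_of_orthogonal (huv : inner ℝ u v = 0) (hn : ‖v‖ = ‖u‖)
    (hu : u ≠ 0) {A B P Q : V} (hB : B - A = u) {p q r s : ℝ}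
    (hP : P - A = p • u + q • v) (hQ : Q - A = r • u + s • v)
    (h : (affineSpan ℝ ({A, B} : Set V)).WOppSide P Q) : q * s ≤ 0 := by
  have hA : A ∈ affineSpan ℝ ({A, B} : Set V) := left_mem_affineSpan_pair ℝ A B
  have hQ' : (2 : ℝ) • A - Q - A = (-r) • u + (-s) • v := by
    rw [show (2 : ℝ) • A - Q - A = -(Q - A) by module, hQ]
    module
  have hside : (affineSpan ℝ ({A, B} : Set V)).WSameSide P ((2 : ℝ) • A - Q) := by
    obtain ⟨a, ha, b, hb, hray⟩ := h
    refine ⟨a, ha, (2 : ℝ) • A - b, ?_, ?_⟩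
    · have := AffineMap.lineMap_mem (-1 : ℝ) hA hb
      convert this using 1
      simp only [AffineMap.lineMap_apply, vsub_eq_sub, vadd_eq_add]
      module
    · convert hray using 1
      simp only [vsub_eq_sub]
      module
  have := AffineSubspace.WSameSide.mul_nonneg_of_orthogonal huv hn hu hB hP hQ' hside
  linarith

end Frame

/-- Points in the interior of a nondegenerate triangle have positive barycentric coordinates. -/
theorem exists_pos_barycentric_of_mem_interior {A B C X : Pt2}
    (hindep : AffineIndependent ℝ ![A, B, C])
    (hX : X ∈ interior (convexHull ℝ ({A, B, C} : Set Pt2))) :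
    ∃ β γ : ℝ, 0 < β ∧ 0 < γ ∧ β + γ < 1 ∧ X - A = β • (B - A) + γ • (C - A) := by
  have htop : affineSpan ℝ (Set.range ![A, B, C]) = ⊤ := by
    rw [hindep.affineSpan_eq_top_iff_card_eq_finrank_add_one]
    simp
  let b : AffineBasis (Fin 3) ℝ Pt2 := ⟨![A, B, C], hindep, htop⟩
  have hb : (b : Fin 3 → Pt2) = ![A, B, C] := rfl
  have hrange : Set.range b = {A, B, C} := by
    rw [hb]
    ext z
    simp only [Set.mem_range, Fin.exists_fin_succ, Set.mem_insert_iff, Set.mem_singleton_iff]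
    simp [eq_comm, or_comm]
  rw [← hrange, b.interior_convexHull] at hX
  have hsum := b.sum_coord_apply_eq_one X
  have hlin := b.linear_combination_coord_eq_self X
  rw [Fin.sum_univ_three] at hsum hlin
  simp only [hb, Matrix.cons_val] at hlin
  refine ⟨b.coord 1 X, b.coord 2 X, hX 1, hX 2, by linarith [hX 0], ?_⟩
  have h0 : b.coord 0 X = 1 - b.coord 1 X - b.coord 2 X := by linarith
  rw [h0] at hlin
  nth_rewrite 1 [← hlin]
  module

/-- A nondegenerate triangle `ABC` admits an orthogonal frame at `A` with first vector `B - A`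
in which `C` lies above the first axis. -/
theorem exists_orthogonal_frame {A B C : Pt2} (hindep : AffineIndependent ℝ ![A, B, C]) :
    B - A ≠ 0 ∧ ∃ v : Pt2, inner ℝ (B - A) v = 0 ∧ ‖v‖ = ‖B - A‖ ∧
      (∀ w : Pt2, ∃ p q : ℝ, w = p • (B - A) + q • v) ∧
      ∃ c d : ℝ, 0 < d ∧ C - A = c • (B - A) + d • v := by
  have hAB : B - A ≠ 0 := by
    have := hindep.injective.ne (show (1 : Fin 3) ≠ 0 by decide)
    exact sub_ne_zero.mpr this
  refine ⟨hAB, ?_⟩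
  generalize hu : B - A = u at hAB
  have hpos : 0 < u 0 ^ 2 + u 1 ^ 2 := by
    have h := EuclideanSpace.real_norm_sq_eq u
    rw [Fin.sum_univ_two] at h
    rw [← h]
    positivity
  have hframe : ∀ ε : ℝ, ε ^ 2 = 1 →
      inner ℝ u !₂[-(ε * u 1), ε * u 0] = 0 ∧ ‖!₂[-(ε * u 1), ε * u 0]‖ = ‖u‖ ∧
      ∀ w : Pt2, ∃ p q : ℝ, w = p • u + q • !₂[-(ε * u 1), ε * u 0] := by
    intro ε hε
    refine ⟨?_, ?_, fun w => ⟨(w 0 * u 0 + w 1 * u 1) / (u 0 ^ 2 + u 1 ^ 2),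
      ε * (w 1 * u 0 - w 0 * u 1) / (u 0 ^ 2 + u 1 ^ 2), ?_⟩⟩
    · simp [PiLp.inner_apply, Fin.sum_univ_two]
      ring
    · rw [EuclideanSpace.norm_eq, EuclideanSpace.norm_eq]
      congr 1
      simp [Fin.sum_univ_two, mul_pow, hε]
      ring
    · ext i
      fin_cases i
      · simp
        field_simp
        linear_combination (u 1 * (w 1 * u 0 - w 0 * u 1)) * hε
      · simp
        field_simp
        linear_combination (-u 0 * (w 1 * u 0 - w 0 * u 1)) * hε
  obtain ⟨-, -, hspan⟩ := hframe 1 (by norm_num)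
  obtain ⟨c, d, hC⟩ := hspan (C - A)
  have hd : d ≠ 0 := by
    rintro rfl
    have hcol : Collinear ℝ ({A, B, C} : Set Pt2) := by
      rw [collinear_iff_of_mem (p₀ := A) (by simp)]
      refine ⟨u, ?_⟩
      simp only [Set.mem_insert_iff, Set.mem_singleton_iff, forall_eq_or_imp, forall_eq]
      refine ⟨⟨0, by simp⟩, ⟨1, by simp [← hu]⟩, ⟨c, ?_⟩⟩
      rw [zero_smul, add_zero] at hC
      simp [← hC]
    exact affineIndependent_iff_not_collinear_set.mp hindep hcol
  rcases lt_or_gt_of_ne hd with hd | hd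
  · obtain ⟨h₁, h₂, h₃⟩ := hframe (-1) (by norm_num)
    refine ⟨_, h₁, h₂, h₃, c, -d, by linarith, ?_⟩
    rw [hC]
    ext i
    fin_cases i <;> simp
  · obtain ⟨h₁, h₂, h₃⟩ := hframe 1 (by norm_num)
    exact ⟨_, h₁, h₂, h₃, c, d, hd, hC⟩

/-- For isogonal conjugates `(x, y)` and `(x', y')` in the triangle `(0, 0)`, `(1, 0)`, `(c, d)`,
the heights `s`, `t`, `o` of the centers of the circles through `(0, 0)`, `(1, 0)` and
respectively `(x, y)`, `(x', y')`, `(c, d)` satisfy `(s - o) * (t - o) = o ^ 2 + 1 / 4`. -/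
theorem isogonal_center_heights_mul {x y x' y' c d s t o : ℝ}
    (hy : 0 < y) (hy' : 0 < y') (hd : 0 < d)
    (hs : x ^ 2 + y ^ 2 - x = 2 * s * y) (ht : x' ^ 2 + y' ^ 2 - x' = 2 * t * y')
    (ho : c ^ 2 + d ^ 2 - c = 2 * o * d)
    (hA : x * (x' * d - y' * c) = (x' * c + y' * d) * y)
    (hB : (1 - x) * ((1 - x') * d + y' * (c - 1)) = ((1 - x') * (1 - c) + y' * d) * y) :
    (s - o) * (t - o) = o ^ 2 + 1 / 4 := by
  have key : (x ^ 2 + y ^ 2 - x) * (x' ^ 2 + y' ^ 2 - x') * d - (c ^ 2 + d ^ 2 - c) *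
      ((x ^ 2 + y ^ 2 - x) * y' + (x' ^ 2 + y' ^ 2 - x') * y) - y * y' * d = 0 := by
    linear_combination
      (((1 - x) * (1 - x') - y * y') * (1 - c) + ((1 - x) * y' + y * (1 - x')) * d) * hA +
      ((x * x' - y * y') * c + (x * y' + y * x') * d) * hB
  rw [hs, ht, ho] at key
  have hne : 4 * (y * y' * d) ≠ 0 := by positivity
  refine mul_left_cancel₀ hne ?_
  linear_combination key

/-- Circles centered at heights `s` and `t` over the midpoint of a common chord are related by the
homotheties centered at heights `o + ρ` and `o - ρ` when `(s - o) * (t - o) = ρ ^ 2`. -/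
theorem homothety_ratio_of_mul_eq {s t o ρ : ℝ} (hσ : s - o < 0)
    (hρ : ρ ^ 2 = o ^ 2 + 1 / 4) (hmul : (s - o) * (t - o) = ρ ^ 2) :
    t - (o + ρ) = -ρ / (s - o) * (s - (o + ρ)) ∧
      t ^ 2 + 1 / 4 = (ρ / (s - o)) ^ 2 * (s ^ 2 + 1 / 4) := by
  have hne : s - o ≠ 0 := hσ.ne
  constructor
  · field_simp
    linear_combination hmul
  · rw [div_pow, div_mul_eq_mul_div, eq_div_iff (pow_ne_zero 2 hne)]
    linear_combination ((s - o) * (t - o) + ρ ^ 2 + 2 * o * (s - o)) * hmul +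
      (ρ ^ 2 - (s - o) ^ 2) * hρ

/-- Let `X` and `Y` be isogonal conjugate points in the interior of a nondegenerate
triangle `ABC` in the Euclidean plane, let `M` and `N` be the points of the circumcircle
of `ABC` equidistant from `A` and `B`, with `M` strictly on the opposite side of line
`AB` from `C` and `N` strictly on the same side as `C`, and let `S`, `T` be the
circumcenters of triangles `ABX`, `ABY`, whose circumradii `dist S A`, `dist T A` are
assumed distinct. Then `N` is the external homothety center and `M` is the internal
homothety center of the circumcircles of `ABX` and `ABY`. -/
theorem arc_midpoints_are_homothety_centers
    (A B C X Y : Pt2) (hindep : AffineIndependent ℝ ![A, B, C])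
    (hX : X ∈ interior (convexHull ℝ ({A, B, C} : Set Pt2)))
    (hY : Y ∈ interior (convexHull ℝ ({A, B, C} : Set Pt2)))
    (hisoA : EuclideanGeometry.angle X A B = EuclideanGeometry.angle Y A C)
    (hisoB : EuclideanGeometry.angle X B A = EuclideanGeometry.angle Y B C)
    (hisoC : EuclideanGeometry.angle X C A = EuclideanGeometry.angle Y C B)
    (O₀ : Pt2) (R : ℝ) (hR : 0 < R)
    (hOA : dist O₀ A = R) (hOB : dist O₀ B = R) (hOC : dist O₀ C = R)
    (M N : Pt2) (hM : dist O₀ M = R) (hN : dist O₀ N = R)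
    (hMAB : dist M A = dist M B) (hNAB : dist N A = dist N B)
    (hMside : (affineSpan ℝ ({A, B} : Set Pt2)).SOppSide M C)
    (hNside : (affineSpan ℝ ({A, B} : Set Pt2)).SSameSide N C)
    (S T : Pt2)
    (hSA : dist S A = dist S B) (hSX : dist S A = dist S X)
    (hTA : dist T A = dist T B) (hTY : dist T A = dist T Y)
    (hrad : dist S A ≠ dist T A) :
    (∃ k : ℝ, 0 < k ∧ T - N = k • (S - N) ∧ dist T A = |k| * dist S A) ∧
    (∃ k : ℝ, k < 0 ∧ T - M = k • (S - M) ∧ dist T A = |k| * dist S A) := by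
  obtain ⟨hu, v, huv, hn, hspan, c, d, hd, hC⟩ := exists_orthogonal_frame hindep
  obtain ⟨βX, γX, hβX, hγX, hβγX, hXbar⟩ := exists_pos_barycentric_of_mem_interior hindep hX
  obtain ⟨βY, γY, hβY, hγY, hβγY, hYbar⟩ := exists_pos_barycentric_of_mem_interior hindep hY
  generalize hBA : B - A = u at *
  have hL : 0 < ‖u‖ ^ 2 := by positivity
  have hA : A - A = (0 : ℝ) • u + (0 : ℝ) • v := by simp
  have hB : B - A = (1 : ℝ) • u + (0 : ℝ) • v := by simp [hBA]
  obtain ⟨x, hx⟩ : ∃ x, x = βX + γX * c := ⟨_, rfl⟩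
  obtain ⟨y, hy⟩ : ∃ y, y = γX * d := ⟨_, rfl⟩
  obtain ⟨x', hx'⟩ : ∃ x', x' = βY + γY * c := ⟨_, rfl⟩
  obtain ⟨y', hy'⟩ : ∃ y', y' = γY * d := ⟨_, rfl⟩
  have hXc : X - A = x • u + y • v := by
    rw [hXbar, hC, hx, hy]
    module
  have hYc : Y - A = x' • u + y' • v := by
    rw [hYbar, hC, hx', hy']
    module
  have hy0 : 0 < y := hy ▸ mul_pos hγX hd
  have hy0' : 0 < y' := hy' ▸ mul_pos hγY hd
  have coords : ∀ P : Pt2, dist P A = dist P B →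
      ∃ p : ℝ, P - A = (1 / 2 : ℝ) • u + p • v := by
    intro P hP
    obtain ⟨p, q, hpq⟩ := hspan (P - A)
    have h := congrArg (· ^ 2) hP
    simp only [dist_sq_of_orthogonal huv hn hpq hA, dist_sq_of_orthogonal huv hn hpq hB] at h
    have h' := mul_left_cancel₀ hL.ne' h
    have hp : p = 1 / 2 := by linarith
    exact ⟨q, hp ▸ hpq⟩
  have circle : ∀ {P Q : Pt2} {p a b : ℝ}, P - A = (1 / 2 : ℝ) • u + p • v →
      Q - A = a • u + b • v → dist P A = dist P Q → a ^ 2 + b ^ 2 - a = 2 * p * b := by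
    intro P Q p a b hP hQ hPQ
    have h := congrArg (· ^ 2) hPQ
    simp only [dist_sq_of_orthogonal huv hn hP hA, dist_sq_of_orthogonal huv hn hP hQ] at h
    have h' := mul_left_cancel₀ hL.ne' h
    linarith
  obtain ⟨s, hS⟩ := coords S hSA
  obtain ⟨t, hT⟩ := coords T hTA
  obtain ⟨o, hO⟩ := coords O₀ (hOA.trans hOB.symm)
  obtain ⟨m, hMc⟩ := coords M hMAB
  obtain ⟨n, hNc⟩ := coords N hNAB
  have hs := circle hS hXc hSX
  have ht := circle hT hYc hTY
  have ho := circle hO hC (hOA.trans hOC.symm)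
  have hm := circle hO hMc (hOA.trans hM.symm)
  have hn' := circle hO hNc (hOA.trans hN.symm)
  have hm0 : m ≤ 0 := nonpos_of_mul_nonpos_left
    (AffineSubspace.WOppSide.mul_nonpos_of_orthogonal huv hn hu hBA hMc hC hMside.wOppSide) hd
  have hn0 : 0 ≤ n := nonneg_of_mul_nonneg_left
    (AffineSubspace.WSameSide.mul_nonneg_of_orthogonal huv hn hu hBA hNc hC hNside.wSameSide) hd
  have hisoA' := dot_mul_cross_eq_of_angle_eq huv hn hu hXc hB hYc hC hisoA hy0
    (show 0 < x' * d - y' * c by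
      rw [hx', hy']
      linarith [mul_pos hβY hd]) (by ring) (by ring)
  have fromB : ∀ {P : Pt2} {a b : ℝ}, P - A = a • u + b • v →
      P - B = (a - 1) • u + b • v := by
    intro P a b hP
    rw [← sub_sub_sub_cancel_right P B A, hP, hBA]
    module
  have hisoB' := dot_mul_cross_eq_of_angle_eq huv hn hu (fromB hXc) (fromB hA) (fromB hYc)
    (fromB hC) hisoB hy0
    (show 0 < (1 - x') * d + y' * (c - 1) by
      rw [hx', hy']
      linarith [mul_pos (sub_pos.mpr hβγY) hd]) (by ring) (by ring)
  have hmul := isogonal_center_heights_mul hy0 hy0' hd hs ht ho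
    (by linear_combination hisoA') (by linear_combination hisoB')
  have hσ : s - o < 0 := by
    have hpow : x ^ 2 + y ^ 2 - x - 2 * o * y < 0 := by
      have : x ^ 2 + y ^ 2 - x - 2 * o * y =
          -(βX * (1 - βX - γX) + γX * (1 - βX - γX) * (c ^ 2 + d ^ 2) +
            βX * γX * ((c - 1) ^ 2 + d ^ 2)) := by
        rw [hx, hy]
        linear_combination γX * ho
      rw [this]
      have hα : 0 < 1 - βX - γX := by linarith
      have : 0 < βX * (1 - βX - γX) + γX * (1 - βX - γX) * (c ^ 2 + d ^ 2) +
          βX * γX * ((c - 1) ^ 2 + d ^ 2) := by positivity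
      linarith
    refine neg_of_mul_neg_left (b := 2 * y) ?_ (by positivity)
    linarith
  have hρ : (n - o) ^ 2 = o ^ 2 + 1 / 4 := by linarith
  have hρ0 : 0 < n - o := by
    by_contra! h
    linarith [mul_nonneg hn0 (show 0 ≤ 2 * o - n by linarith)]
  have hmn : m = o - (n - o) := by
    have h0 : 0 < o - m := by
      by_contra! h
      linarith [mul_nonneg (neg_nonneg.mpr hm0) (show 0 ≤ m - 2 * o by linarith)]
    have : o - m = n - o := (sq_eq_sq₀ h0.le hρ0.le).mp (by linarith)
    linarith
  obtain ⟨hN₁, hrad₁⟩ := homothety_ratio_of_mul_eq hσ hρ (hmul.trans hρ.symm)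
  obtain ⟨hM₁, -⟩ := homothety_ratio_of_mul_eq (ρ := -(n - o)) hσ (by rw [neg_sq, hρ])
    (by rw [neg_sq, hρ, hmul])
  have homothety : ∀ {P : Pt2} {p k : ℝ}, P - A = (1 / 2 : ℝ) • u + p • v →
      t - p = k * (s - p) → T - P = k • (S - P) := by
    intro P p k hP hk
    rw [← sub_sub_sub_cancel_right T P A, ← sub_sub_sub_cancel_right S P A, hP, hS, hT]
    have : t = p + k * (s - p) := by linarith
    rw [this]
    module
  have radius : ∀ k : ℝ, k ^ 2 = ((n - o) / (s - o)) ^ 2 → dist T A = |k| * dist S A := by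
    intro k hk
    refine (sq_eq_sq₀ dist_nonneg (by positivity)).mp ?_
    rw [mul_pow, sq_abs, hk, dist_sq_of_orthogonal huv hn hT hA,
      dist_sq_of_orthogonal huv hn hS hA]
    linear_combination ‖u‖ ^ 2 * hrad₁
  refine ⟨⟨-(n - o) / (s - o), div_pos_of_neg_of_neg (by linarith) hσ, homothety hNc ?_,
    radius _ (by ring)⟩, ⟨(n - o) / (s - o), div_neg_of_pos_of_neg hρ0 hσ, homothety hMc ?_,
    radius _ rfl⟩⟩
  · rwa [add_sub_cancel] at hN₁
  · rwa [neg_neg, ← sub_eq_add_neg, ← hmn] at hM₁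

end
end

section
/- Let a, b, c be nonzero real numbers and let A = (−a, b, c), B = (a, −b, c), C = (a, b, −c), D = (−a, −b, −c) be points of ℝ³ (so the bimedian ℓ_C of tetrahedron ABCD joining the midpoints of DC and AB is the z-axis). Let P = (x, y, z) be a point lying on none of the four face planes of ABCD and not on the z-axis, and let Q = (−x, −y, z) be the reflection of P in the z-axis. Then Q is an isogonal conjugate of P with respect to ABCD if and only if a·b·z + c·x·y = 0, i.e. if and only if P lies on the hyperbolic paraboloid z = −(c/(ab))·x·y. -/
open EuclideanGeometry
open scoped RealInnerProductSpace

noncomputable section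

abbrev Pt := EuclideanSpace ℝ (Fin 3)

/-- The unit vector in the direction of `v` (junk value `0` if `v = 0`). -/
def unitv (v : Pt) : Pt := ‖v‖⁻¹ • v

/-- The unit vector in the direction of the component of `v` orthogonal to the
unit vector `u`. -/
def orthUnit (v u : Pt) : Pt := unitv (v - ⟪v, u⟫ • u)

/-- The internal bisector plane of tetrahedron `XYZW` along the edge `XY`:
the affine plane through `X` whose direction is spanned by the unit vector `u` along
`Y - X` and the sum of the unit vectors along the components of `Z - X` and `W - X`
orthogonal to `u`. -/
def bisectorPlane (X Y Z W : Pt) : AffineSubspace ℝ Pt :=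
  AffineSubspace.mk' X (Submodule.span ℝ
    {unitv (Y - X), orthUnit (Z - X) (unitv (Y - X)) + orthUnit (W - X) (unitv (Y - X))})

/-- Reflection of `ℝ³` in the internal bisector plane along edge `XY`
(with `Z`, `W` the two remaining vertices). -/
def edgeReflect (X Y Z W : Pt) : Pt ≃ᵃⁱ[ℝ] Pt :=
  haveI : Nonempty (bisectorPlane X Y Z W) := ⟨⟨X, AffineSubspace.self_mem_mk' _ _⟩⟩
  EuclideanGeometry.reflection (bisectorPlane X Y Z W)

/-- `Q` lies in the image of the plane through `X, Y, P` under the reflection of `ℝ³`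
in the internal bisector plane along the edge `XY` (remaining vertices `Z`, `W`). -/
def IsogCond (X Y Z W P Q : Pt) : Prop :=
  Q ∈ ⇑(edgeReflect X Y Z W) '' (affineSpan ℝ ({X, Y, P} : Set Pt) : Set Pt)

/-- `Q` is an isogonal conjugate of `P` with respect to the tetrahedron `ABCD`:
for each of the six edges `XY`, `Q` lies in the image of the plane through `X, Y, P`
under the reflection in the internal bisector plane along `XY`. -/
def IsIsogonalConjugate (A B C D P Q : Pt) : Prop :=
  IsogCond A B C D P Q ∧ IsogCond A C B D P Q ∧ IsogCond A D B C P Q ∧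
  IsogCond B C A D P Q ∧ IsogCond B D A C P Q ∧ IsogCond C D A B P Q

/-- Orthogonal projection of `P` onto the affine plane spanned by `X, Y, Z`. -/
def faceProj (X Y Z P : Pt) : Pt :=
  haveI : Nonempty (affineSpan ℝ ({X, Y, Z} : Set Pt)) :=
    ⟨⟨X, subset_affineSpan ℝ _ (by simp)⟩⟩
  (EuclideanGeometry.orthogonalProjection (affineSpan ℝ ({X, Y, Z} : Set Pt)) P : Pt)

theorem mem_affineSpan_triple_iff (X Y P R : Pt) :
    R ∈ affineSpan ℝ ({X, Y, P} : Set Pt) ↔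
      ∃ s t : ℝ, R - X = s • (Y - X) + t • (P - X) := by
  have hX : X ∈ affineSpan ℝ ({X, Y, P} : Set Pt) := subset_affineSpan ℝ _ (by simp)
  rw [← AffineSubspace.vsub_right_mem_direction_iff_mem hX, direction_affineSpan,
    vectorSpan_eq_span_vsub_set_right ℝ (show X ∈ ({X, Y, P} : Set Pt) by simp)]
  simp only [Set.image_insert_eq, Set.image_singleton, vsub_eq_sub, sub_self,
    Submodule.span_insert_zero, Submodule.mem_span_pair, eq_comm]

theorem edgeReflect_apply (X Y Z W R : Pt) :
    edgeReflect X Y Z W R =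
      (Submodule.span ℝ {unitv (Y - X), orthUnit (Z - X) (unitv (Y - X)) +
        orthUnit (W - X) (unitv (Y - X))}).reflection (R - X) + X := by
  have : Nonempty (bisectorPlane X Y Z W) := ⟨⟨X, AffineSubspace.self_mem_mk' _ _⟩⟩
  have h := EuclideanGeometry.reflection_apply_of_mem (bisectorPlane X Y Z W) R
    (AffineSubspace.self_mem_mk' X _)
  have hdir : (bisectorPlane X Y Z W).direction = Submodule.span ℝ {unitv (Y - X),
      orthUnit (Z - X) (unitv (Y - X)) + orthUnit (W - X) (unitv (Y - X))} :=
    AffineSubspace.direction_mk' _ _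
  simp only [hdir] at h
  exact h

theorem isogCond_iff_edgeReflect_mem (X Y Z W P Q : Pt) :
    IsogCond X Y Z W P Q ↔
      edgeReflect X Y Z W Q ∈ affineSpan ℝ ({X, Y, P} : Set Pt) := by
  have hinv : Function.Involutive (edgeReflect X Y Z W) := by
    have : Nonempty (bisectorPlane X Y Z W) := ⟨⟨X, AffineSubspace.self_mem_mk' _ _⟩⟩
    exact EuclideanGeometry.reflection_involutive _
  rw [IsogCond, hinv.image_eq_preimage_symm]
  rfl

theorem norm_unitv {u : Pt} (hu : u ≠ 0) : ‖unitv u‖ = 1 := by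
  simp [unitv, norm_smul, hu]

/-- If the components of `z` and `w` orthogonal to `u` have the same length, the reflection in
the bisector plane swaps `z` and `w` up to multiples of `u`. -/
theorem exists_reflection_eq_add_smul {u z w : Pt} (hu : u ≠ 0)
    (h : ‖z‖ ^ 2 * ‖u‖ ^ 2 - ⟪z, u⟫ ^ 2 = ‖w‖ ^ 2 * ‖u‖ ^ 2 - ⟪w, u⟫ ^ 2) :
    ∃ r : ℝ, (Submodule.span ℝ {unitv u, orthUnit z (unitv u) +
      orthUnit w (unitv u)}).reflection z = w + r • u := by
  set e := unitv u with he
  set K := Submodule.span ℝ {e, orthUnit z e + orthUnit w e} with hK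
  have hu0 : ‖u‖ ≠ 0 := norm_ne_zero_iff.mpr hu
  have hee : ⟪e, e⟫ = 1 := by
    rw [real_inner_self_eq_norm_sq, norm_unitv hu, one_pow]
  have horth : ∀ v : Pt, ⟪v - ⟪v, e⟫ • e, e⟫ = 0 := fun v => by
    rw [inner_sub_left, real_inner_smul_left, hee]; ring
  have hsq : ∀ v : Pt, ‖v - ⟪v, e⟫ • e‖ ^ 2 * ‖u‖ ^ 2 = ‖v‖ ^ 2 * ‖u‖ ^ 2 - ⟪v, u⟫ ^ 2 := by
    intro v
    have h1 : ‖v - ⟪v, e⟫ • e‖ ^ 2 = ‖v‖ ^ 2 - ⟪v, e⟫ ^ 2 := by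
      rw [← real_inner_self_eq_norm_sq, inner_sub_right, real_inner_smul_right, horth,
        inner_sub_left, real_inner_smul_left, real_inner_self_eq_norm_sq, real_inner_comm v e]
      ring
    have h2 : ⟪v, e⟫ = ‖u‖⁻¹ * ⟪v, u⟫ := real_inner_smul_right _ _ _
    rw [h1, h2]
    field_simp
  set z' := z - ⟪z, e⟫ • e with hz'
  set w' := w - ⟪w, e⟫ • e with hw'
  have hnorm : ‖z'‖ = ‖w'‖ := by
    have h3 : ‖z'‖ ^ 2 = ‖w'‖ ^ 2 :=
      mul_right_cancel₀ (pow_ne_zero 2 hu0) ((hsq z).trans (h.trans (hsq w).symm))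
    exact (sq_eq_sq₀ (norm_nonneg _) (norm_nonneg _)).mp h3
  have hsum : orthUnit z e + orthUnit w e = ‖w'‖⁻¹ • (z' + w') := by
    rw [orthUnit, orthUnit, unitv, unitv, ← hz', ← hw', hnorm, smul_add]
  have heK : e ∈ K := Submodule.subset_span (by simp)
  have hsumK : z' + w' ∈ K := by
    by_cases hw0 : ‖w'‖ = 0
    · rw [norm_eq_zero.mp hw0, norm_eq_zero.mp (hnorm.trans hw0), add_zero]
      exact K.zero_mem
    · have h4 : ‖w'‖⁻¹ • (z' + w') ∈ K := by
        rw [← hsum]; exact Submodule.subset_span (by simp)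
      simpa [smul_smul, hw0] using K.smul_mem ‖w'‖ h4
  have hdiff : z' - w' ∈ Kᗮ := by
    rw [Submodule.mem_orthogonal']
    intro v hv
    obtain ⟨s, t, rfl⟩ := Submodule.mem_span_pair.mp hv
    have h5 : ⟪z' - w', z' + w'⟫ = 0 := by
      rw [real_inner_comm, real_inner_add_sub_eq_zero_iff]; exact hnorm
    rw [hsum, inner_add_right, real_inner_smul_right, real_inner_smul_right,
      real_inner_smul_right, h5, inner_sub_left, horth z, horth w]
    ring
  have hdec : z = (2⁻¹ : ℝ) • (z' + w') + (2⁻¹ : ℝ) • (z' - w') + ⟪z, e⟫ • e := by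
    rw [hz']; module
  refine ⟨(⟪z, e⟫ - ⟪w, e⟫) * ‖u‖⁻¹, ?_⟩
  have hsmul : ((⟪z, e⟫ - ⟪w, e⟫) * ‖u‖⁻¹) • u = (⟪z, e⟫ - ⟪w, e⟫) • e := by
    rw [mul_smul]; rfl
  calc K.reflection z
      = K.reflection ((2⁻¹ : ℝ) • (z' + w') + (2⁻¹ : ℝ) • (z' - w') + ⟪z, e⟫ • e) :=
        congrArg _ hdec
    _ = (2⁻¹ : ℝ) • (z' + w') + (2⁻¹ : ℝ) • -(z' - w') + ⟪z, e⟫ • e := by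
        rw [map_add, map_add, map_smul, map_smul, map_smul,
          Submodule.reflection_mem_subspace_eq_self hsumK,
          Submodule.reflection_mem_subspace_eq_self heK,
          Submodule.reflection_mem_subspace_orthogonalComplement_eq_neg hdiff]
    _ = w + ((⟪z, e⟫ - ⟪w, e⟫) * ‖u‖⁻¹) • u := by
        rw [hsmul, hw']; module

/-- In a tetrahedron whose faces along the edge `XY` have equal heights over `XY`, the isogonality
condition along `XY` is an equality of products of barycentric coordinates. -/
theorem isogCond_iff_mul_eq_mul {X Y Z W P Q : Pt}
    (hind : LinearIndependent ℝ ![Y - X, Z - X, W - X])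
    (hZY : dist Z Y = dist W X) (hZX : dist Z X = dist W Y)
    {p₁ p₂ p₃ q₁ q₂ q₃ : ℝ} (hp₃ : p₃ ≠ 0)
    (hP : P - X = p₁ • (Y - X) + p₂ • (Z - X) + p₃ • (W - X))
    (hQ : Q - X = q₁ • (Y - X) + q₂ • (Z - X) + q₃ • (W - X)) :
    IsogCond X Y Z W P Q ↔ p₂ * q₂ = p₃ * q₃ := by
  have hu : Y - X ≠ 0 := hind.ne_zero 0
  rw [isogCond_iff_edgeReflect_mem, mem_affineSpan_triple_iff, edgeReflect_apply,
    add_sub_cancel_right]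
  have hheight : ‖Z - X‖ ^ 2 * ‖Y - X‖ ^ 2 - ⟪Z - X, Y - X⟫ ^ 2 =
      ‖W - X‖ ^ 2 * ‖Y - X‖ ^ 2 - ⟪W - X, Y - X⟫ ^ 2 := by
    have h1 : ‖(Z - X) - (Y - X)‖ = ‖W - X‖ := by
      rw [sub_sub_sub_cancel_right, ← dist_eq_norm, ← dist_eq_norm, hZY]
    have h2 : ‖(W - X) - (Y - X)‖ = ‖Z - X‖ := by
      rw [sub_sub_sub_cancel_right, ← dist_eq_norm, ← dist_eq_norm, hZX]
    have h3 := norm_sub_sq_real (Z - X) (Y - X)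
    have h4 := norm_sub_sq_real (W - X) (Y - X)
    rw [h1] at h3
    rw [h2] at h4
    have h5 : ⟪Z - X, Y - X⟫ + ⟪W - X, Y - X⟫ = ‖Y - X‖ ^ 2 := by linarith
    rw [← h5]
    have h6 : ‖Z - X‖ ^ 2 - ‖W - X‖ ^ 2 = ⟪Z - X, Y - X⟫ - ⟪W - X, Y - X⟫ := by linarith
    linear_combination (⟪Z - X, Y - X⟫ + ⟪W - X, Y - X⟫) * h6
  obtain ⟨r, hr⟩ := exists_reflection_eq_add_smul hu hheight
  obtain ⟨r', hr'⟩ := exists_reflection_eq_add_smul hu hheight.symm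
  rw [add_comm (orthUnit (W - X) _)] at hr'
  have hself : (Submodule.span ℝ {unitv (Y - X), orthUnit (Z - X) (unitv (Y - X)) +
        orthUnit (W - X) (unitv (Y - X))}).reflection (Y - X) = Y - X := by
    apply Submodule.reflection_mem_subspace_eq_self
    have h7 : Y - X = ‖Y - X‖ • unitv (Y - X) := by
      rw [unitv, smul_smul, mul_inv_cancel₀ (norm_ne_zero_iff.mpr hu), one_smul]
    rw [h7]
    refine Submodule.smul_mem _ _ (Submodule.subset_span ?_)
    rw [← h7]
    simp
  rw [hQ, map_add, map_add, map_smul, map_smul, map_smul, hr, hr', hself, hP]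
  constructor
  · rintro ⟨s, t, hst⟩
    have h8 : (q₁ + q₂ * r + q₃ * r' - s - t * p₁) • (Y - X) + (q₃ - t * p₂) • (Z - X) +
        (q₂ - t * p₃) • (W - X) = 0 := by
      rw [← sub_eq_zero] at hst
      rw [← hst]
      module
    have h9 := Fintype.linearIndependent_iff.mp hind
      ![q₁ + q₂ * r + q₃ * r' - s - t * p₁, q₃ - t * p₂, q₂ - t * p₃]
      (by simpa [Fin.sum_univ_three] using h8)
    have h10 : q₃ - t * p₂ = 0 := h9 1
    have h11 : q₂ - t * p₃ = 0 := h9 2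
    linear_combination p₂ * h11 - p₃ * h10
  · intro hpq
    have hq₃ : q₃ = q₂ / p₃ * p₂ := by field_simp; linarith
    have hq₂ : q₂ = q₂ / p₃ * p₃ := by field_simp
    refine ⟨q₁ + q₂ * r + q₃ * r' - q₂ / p₃ * p₁, q₂ / p₃, ?_⟩
    generalize q₂ / p₃ = t at *
    subst hq₂ hq₃
    module

theorem ne_zero_of_notMem_affineSpan {X Y Z W P : Pt} {p₁ p₂ p₃ : ℝ}
    (hP : P - X = p₁ • (Y - X) + p₂ • (Z - X) + p₃ • (W - X))
    (h : P ∉ affineSpan ℝ ({X, Y, Z} : Set Pt)) : p₃ ≠ 0 := by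
  rintro rfl
  exact h ((mem_affineSpan_triple_iff X Y Z P).mpr ⟨p₁, p₂, by simpa using hP⟩)

theorem linearIndependent_of_det_ne_zero {u v w : Pt}
    (h : (Matrix.of ![u.ofLp, v.ofLp, w.ofLp]).det ≠ 0) : LinearIndependent ℝ ![u, v, w] := by
  have h1 := Matrix.linearIndependent_rows_of_det_ne_zero h
  refine LinearIndependent.of_comp (WithLp.linearEquiv 2 ℝ (Fin 3 → ℝ)).toLinearMap ?_
  have h2 : (WithLp.linearEquiv 2 ℝ (Fin 3 → ℝ)).toLinearMap ∘ ![u, v, w] =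
      fun i => Matrix.of ![u.ofLp, v.ofLp, w.ofLp] i := by
    funext i
    fin_cases i <;> rfl
  rw [h2]
  exact h1

theorem sub_eq_of_eq_barycentric {X Y Z W P : Pt} {p₀ p₁ p₂ p₃ : ℝ}
    (hsum : p₀ + p₁ + p₂ + p₃ = 1) (hP : P = p₀ • X + p₁ • Y + p₂ • Z + p₃ • W) :
    P - X = p₁ • (Y - X) + p₂ • (Z - X) + p₃ • (W - X) := by
  obtain rfl : p₀ = 1 - p₁ - p₂ - p₃ := by linarith
  rw [hP]
  module

/-- Let `a, b, c` be nonzero reals and `A = (−a, b, c)`, `B = (a, −b, c)`,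
`C = (a, b, −c)`, `D = (−a, −b, −c)`, so that the bimedian `ℓ_C` of the isosceles
tetrahedron `ABCD` joining the midpoints of `DC` and `AB` is the `z`-axis. Let
`P = (x, y, z)` lie on none of the four face planes and not on the `z`-axis, and let
`Q = (−x, −y, z)` be the reflection of `P` in the `z`-axis. Then `Q` is an isogonal
conjugate of `P` with respect to `ABCD` if and only if `a·b·z + c·x·y = 0`, i.e. iff `P`
lies on the hyperbolic paraboloid `z = −(c/(ab))·x·y`. -/
theorem reflection_in_bimedian_isogonal_iff_hyperbolic_paraboloid
    (a b c x y z : ℝ) (ha : a ≠ 0) (hb : b ≠ 0) (hc : c ≠ 0)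
    (A B C D P Q : Pt)
    (hA : A = ![-a, b, c]) (hB : B = ![a, -b, c])
    (hC : C = ![a, b, -c]) (hD : D = ![-a, -b, -c])
    (hP : P = ![x, y, z]) (hQ : Q = ![-x, -y, z])
    (hP₁ : P ∉ affineSpan ℝ ({B, C, D} : Set Pt))
    (hP₂ : P ∉ affineSpan ℝ ({A, C, D} : Set Pt))
    (hP₃ : P ∉ affineSpan ℝ ({A, B, D} : Set Pt))
    (hP₄ : P ∉ affineSpan ℝ ({A, B, C} : Set Pt))
    (haxis : ¬(x = 0 ∧ y = 0)) :
    IsIsogonalConjugate A B C D P Q ↔ a * b * z + c * x * y = 0 := by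
  have habc : a * b * c ≠ 0 := mul_ne_zero (mul_ne_zero ha hb) hc
  obtain ⟨pA, hpA⟩ : ∃ p, p = (1 - x / a + y / b + z / c) / 4 := ⟨_, rfl⟩
  obtain ⟨pB, hpB⟩ : ∃ p, p = (1 + x / a - y / b + z / c) / 4 := ⟨_, rfl⟩
  obtain ⟨pC, hpC⟩ : ∃ p, p = (1 + x / a + y / b - z / c) / 4 := ⟨_, rfl⟩
  obtain ⟨pD, hpD⟩ : ∃ p, p = (1 - x / a - y / b - z / c) / 4 := ⟨_, rfl⟩
  have hdiff : pA * pB - pC * pD = (a * b * z + c * x * y) / (4 * (a * b * c)) := by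
    rw [hpA, hpB, hpC, hpD]; field_simp; ring
  have hsum : pA + pB + pC + pD = 1 := by rw [hpA, hpB, hpC, hpD]; ring
  have hPbary : P = pA • A + pB • B + pC • C + pD • D := by
    ext i
    fin_cases i <;> simp [hA, hB, hC, hD, hP, hpA, hpB, hpC, hpD] <;> field_simp <;> ring
  have hQbary : Q = pB • A + pA • B + pD • C + pC • D := by
    ext i
    fin_cases i <;> simp [hA, hB, hC, hD, hQ, hpA, hpB, hpC, hpD] <;> field_simp <;> ring
  have hABCD : dist A B = dist C D := by
    simp [EuclideanSpace.dist_eq, Fin.sum_univ_three, Real.dist_eq, hA, hB, hC, hD]; ring_nf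
  have hACBD : dist A C = dist B D := by
    simp [EuclideanSpace.dist_eq, Fin.sum_univ_three, Real.dist_eq, hA, hB, hC, hD]; ring_nf
  have hADBC : dist A D = dist B C := by
    simp [EuclideanSpace.dist_eq, Fin.sum_univ_three, Real.dist_eq, hA, hB, hC, hD]; ring_nf
  have hli : ∀ u v w : Pt,
      (Matrix.of ![u.ofLp, v.ofLp, w.ofLp]).det ^ 2 = (16 * (a * b * c)) ^ 2 →
        LinearIndependent ℝ ![u, v, w] := fun u v w h =>
    linearIndependent_of_det_ne_zero fun h0 => by
      rw [h0, zero_pow two_ne_zero] at h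
      exact mul_ne_zero (by norm_num) habc (pow_eq_zero_iff two_ne_zero |>.mp h.symm)
  have hpA₀ : pA ≠ 0 := ne_zero_of_notMem_affineSpan
    (sub_eq_of_eq_barycentric (p₀ := pB) (p₁ := pC) (p₂ := pD) (by linarith)
      (by rw [hPbary]; abel)) hP₁
  have hpB₀ : pB ≠ 0 := ne_zero_of_notMem_affineSpan
    (sub_eq_of_eq_barycentric (p₀ := pA) (p₁ := pC) (p₂ := pD) (by linarith)
      (by rw [hPbary]; abel)) hP₂
  have hpC₀ : pC ≠ 0 := ne_zero_of_notMem_affineSpan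
    (sub_eq_of_eq_barycentric (p₀ := pA) (p₁ := pB) (p₂ := pD) (by linarith)
      (by rw [hPbary]; abel)) hP₃
  have hpD₀ : pD ≠ 0 := ne_zero_of_notMem_affineSpan
    (sub_eq_of_eq_barycentric (p₀ := pA) (p₁ := pB) (p₂ := pC) (by linarith)
      hPbary) hP₄
  have hAB : IsogCond A B C D P Q ↔ pC * pD = pD * pC :=
    isogCond_iff_mul_eq_mul
      (hli _ _ _ (by simp [Matrix.det_fin_three, hA, hB, hC, hD]; ring))
      (by rw [dist_comm C B, dist_comm D A]; exact hADBC.symm)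
      (by rw [dist_comm C A, dist_comm D B]; exact hACBD) hpD₀
      (sub_eq_of_eq_barycentric (p₀ := pA) (p₁ := pB) (by linarith) hPbary)
      (sub_eq_of_eq_barycentric (p₀ := pB) (p₁ := pA) (by linarith)
        hQbary)
  have hAC : IsogCond A C B D P Q ↔ pB * pA = pD * pC :=
    isogCond_iff_mul_eq_mul
      (hli _ _ _ (by simp [Matrix.det_fin_three, hA, hB, hC, hD]; ring))
      (by rw [dist_comm D A]; exact hADBC.symm)
      (by rw [dist_comm B A, dist_comm D C]; exact hABCD) hpD₀
      (sub_eq_of_eq_barycentric (p₀ := pA) (p₁ := pC) (by linarith) (by rw [hPbary]; abel))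
      (sub_eq_of_eq_barycentric (p₀ := pB) (p₁ := pD) (by linarith)
        (by rw [hQbary]; abel))
  have hAD : IsogCond A D B C P Q ↔ pB * pA = pC * pD :=
    isogCond_iff_mul_eq_mul
      (hli _ _ _ (by simp [Matrix.det_fin_three, hA, hB, hC, hD]; ring))
      (by rw [dist_comm C A]; exact hACBD.symm) (by rw [dist_comm B A]; exact hABCD) hpC₀
      (sub_eq_of_eq_barycentric (p₀ := pA) (p₁ := pD) (by linarith) (by rw [hPbary]; abel))
      (sub_eq_of_eq_barycentric (p₀ := pB) (p₁ := pC) (by linarith)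
        (by rw [hQbary]; abel))
  have hBC : IsogCond B C A D P Q ↔ pA * pB = pD * pC :=
    isogCond_iff_mul_eq_mul
      (hli _ _ _ (by simp [Matrix.det_fin_three, hA, hB, hC, hD]; ring))
      (by rw [dist_comm D B]; exact hACBD) (by rw [dist_comm D C]; exact hABCD) hpD₀
      (sub_eq_of_eq_barycentric (p₀ := pB) (p₁ := pC) (by linarith) (by rw [hPbary]; abel))
      (sub_eq_of_eq_barycentric (p₀ := pA) (p₁ := pD) (by linarith)
        (by rw [hQbary]; abel))
  have hBD : IsogCond B D A C P Q ↔ pA * pB = pC * pD :=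
    isogCond_iff_mul_eq_mul
      (hli _ _ _ (by simp [Matrix.det_fin_three, hA, hB, hC, hD]; ring))
      (by rw [dist_comm C B]; exact hADBC) hABCD hpC₀
      (sub_eq_of_eq_barycentric (p₀ := pB) (p₁ := pD) (by linarith) (by rw [hPbary]; abel))
      (sub_eq_of_eq_barycentric (p₀ := pA) (p₁ := pC) (by linarith)
        (by rw [hQbary]; abel))
  have hCD : IsogCond C D A B P Q ↔ pA * pB = pB * pA :=
    isogCond_iff_mul_eq_mul
      (hli _ _ _ (by simp [Matrix.det_fin_three, hA, hB, hC, hD]; ring))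
      hADBC hACBD hpB₀
      (sub_eq_of_eq_barycentric (p₀ := pC) (p₁ := pD) (by linarith) (by rw [hPbary]; abel))
      (sub_eq_of_eq_barycentric (p₀ := pD) (p₁ := pC) (by linarith)
        (by rw [hQbary]; abel))
  have hmain : pA * pB = pC * pD ↔ a * b * z + c * x * y = 0 := by
    rw [← sub_eq_zero, hdiff, div_eq_zero_iff, or_iff_left (mul_ne_zero four_ne_zero habc)]
  rw [IsIsogonalConjugate, hAB, hAC, hAD, hBC, hBD, hCD, ← hmain]
  constructor
  · rintro ⟨-, h, -⟩
    linarith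
  · intro h
    refine ⟨?_, ?_, ?_, ?_, ?_, ?_⟩ <;> linarith

end
end

section
/- Let ABCD be an isosceles tetrahedron with circumsphere Ω, and let X ∈ Ω with X ∉ {A, B, C, D}. Let ℓ_C be the bimedian of ABCD joining the midpoints of edges DC and AB. Suppose X_C is a point with X_C ≠ X lying on both the circumcircle of triangle XDC and the circumcircle of triangle XAB. Then the reflection of X_C in the line ℓ_C (the image of X_C under the reflection of ℝ³ in the one-dimensional affine subspace ℓ_C) is an isogonal conjugate of X with respect to ABCD. -/
open EuclideanGeometry
open scoped RealInnerProductSpace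

noncomputable section

/-- Reflection of `ℝ³` in the line through `U` and `V`. -/
def lineReflect (U V : Pt) : Pt ≃ᵃⁱ[ℝ] Pt :=
  haveI : Nonempty (affineSpan ℝ ({U, V} : Set Pt)) :=
    ⟨⟨U, subset_affineSpan ℝ _ (by simp)⟩⟩
  EuclideanGeometry.reflection (affineSpan ℝ ({U, V} : Set Pt))

lemma sq_dist_eq_sum (P Q : Pt) :
    dist P Q ^ 2 = (P 0 - Q 0) ^ 2 + (P 1 - Q 1) ^ 2 + (P 2 - Q 2) ^ 2 := by
  rw [EuclideanSpace.dist_sq_eq, Fin.sum_univ_three]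
  simp only [Real.dist_eq, sq_abs]

lemma inner_eq_sum (v w : Pt) : ⟪v, w⟫ = v 0 * w 0 + v 1 * w 1 + v 2 * w 2 := by
  simp only [PiLp.inner_apply, Fin.sum_univ_three, RCLike.inner_apply, conj_trivial]
  ring

lemma edgeReflect_add {X Y Z W p v : Pt} (hp : p ∈ bisectorPlane X Y Z W)
    (hv : v ∈ (bisectorPlane X Y Z W).directionᗮ) :
    edgeReflect X Y Z W (p - v) = p + v := by
  have : Nonempty (bisectorPlane X Y Z W) := ⟨⟨X, AffineSubspace.self_mem_mk' _ _⟩⟩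
  have h := EuclideanGeometry.reflection_orthogonal_vadd hp (neg_mem hv)
  simp only [vadd_eq_add, neg_neg] at h
  rw [show p - v = -v + p by abel, show p + v = v + p by abel]
  exact h

lemma lineReflect_add {U V p v : Pt} (hp : p ∈ affineSpan ℝ ({U, V} : Set Pt))
    (hv : ⟪V - U, v⟫ = 0) : lineReflect U V (p + v) = p - v := by
  have : Nonempty (affineSpan ℝ ({U, V} : Set Pt)) :=
    ⟨⟨U, subset_affineSpan ℝ _ (by simp)⟩⟩
  have hv' : v ∈ (affineSpan ℝ ({U, V} : Set Pt)).directionᗮ := by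
    rw [direction_affineSpan, vectorSpan_pair_rev,
      Submodule.mem_orthogonal_singleton_iff_inner_right]
    exact hv
  have h := EuclideanGeometry.reflection_orthogonal_vadd hp hv'
  simp only [vadd_eq_add] at h
  rw [show p - v = -v + p by abel, show p + v = v + p by abel]
  exact h

/-- If two points `Z`, `W` are at the same distance from the line `XY`, with `a` and `b` the
components of `Z - X` and `W - X` orthogonal to it, then the reflection in the internal bisector
plane along `XY` exchanges `a` and `b`. -/
lemma edgeReflect_apply_s18 {X Y Z W a b : Pt} {i j : ℝ} (hXY : X ≠ Y)
    (hZ : Z - X = i • (Y - X) + a) (hW : W - X = j • (Y - X) + b)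
    (ha : ⟪Y - X, a⟫ = 0) (hb : ⟪Y - X, b⟫ = 0) (hab : ‖a‖ = ‖b‖) (l z w : ℝ) :
    edgeReflect X Y Z W (X + l • (Y - X) + z • a + w • b) =
      X + l • (Y - X) + w • a + z • b := by
  have hn : ‖Y - X‖ ≠ 0 := norm_ne_zero_iff.2 (sub_ne_zero.2 hXY.symm)
  have hcomp : ∀ (v c : Pt) (t : ℝ), v = t • (Y - X) + c → ⟪Y - X, c⟫ = 0 →
      orthUnit v (unitv (Y - X)) = ‖c‖⁻¹ • c := by
    intro v c t hv hc
    have : v - ⟪v, unitv (Y - X)⟫ • unitv (Y - X) = c := by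
      have hin : ⟪v, unitv (Y - X)⟫ = t * ‖Y - X‖ := by
        rw [hv, unitv, inner_smul_right, real_inner_comm, inner_add_right, inner_smul_right, hc,
          real_inner_self_eq_norm_sq]
        field_simp
        ring
      rw [hin, hv, unitv, smul_smul, mul_assoc, mul_inv_cancel₀ hn, mul_one]
      abel
    rw [orthUnit, this, unitv]
  have hdir : (bisectorPlane X Y Z W).direction = Submodule.span ℝ
      {‖Y - X‖⁻¹ • (Y - X), ‖a‖⁻¹ • (a + b)} := by
    rw [bisectorPlane, AffineSubspace.direction_mk', hcomp _ a i hZ ha, hcomp _ b j hW hb, ← hab,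
      ← smul_add, unitv]
  have hdiff : ((z - w) / 2) • (b - a) ∈ (bisectorPlane X Y Z W).directionᗮ := by
    rw [hdir]
    refine Submodule.smul_mem _ _ ((Submodule.mem_orthogonal _ _).2 fun v hv => ?_)
    obtain ⟨s, t, rfl⟩ := Submodule.mem_span_pair.1 hv
    have hperp : ⟪a + b, b - a⟫ = 0 := by
      rw [inner_add_left, inner_sub_right, inner_sub_right, real_inner_self_eq_norm_sq,
        real_inner_self_eq_norm_sq, hab, real_inner_comm]
      ring
    simp only [inner_add_left, inner_smul_left, hperp]
    simp [inner_sub_right, ha, hb]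
  have hmem : X + l • (Y - X) + ((z + w) / 2) • (a + b) ∈ bisectorPlane X Y Z W := by
    have hX : X ∈ bisectorPlane X Y Z W := AffineSubspace.self_mem_mk' _ _
    have h : l • (Y - X) + ((z + w) / 2) • (a + b) ∈ (bisectorPlane X Y Z W).direction := by
      rw [hdir]
      rcases eq_or_ne ‖a‖ 0 with h0 | h0
      · obtain rfl := norm_eq_zero.1 h0
        obtain rfl := norm_eq_zero.1 (hab.symm.trans h0)
        exact Submodule.mem_span_pair.2 ⟨l * ‖Y - X‖, 0, by
          simp [smul_smul, hn]⟩
      · exact Submodule.mem_span_pair.2 ⟨l * ‖Y - X‖, (z + w) / 2 * ‖a‖, by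
          rw [smul_smul, smul_smul, mul_assoc, mul_assoc, mul_inv_cancel₀ hn,
            mul_inv_cancel₀ h0, mul_one, mul_one]⟩
    have := AffineSubspace.vadd_mem_of_mem_direction h hX
    rwa [vadd_eq_add, add_comm, ← add_assoc] at this
  have h := edgeReflect_add hmem hdiff
  rw [show X + l • (Y - X) + z • a + w • b =
    X + l • (Y - X) + ((z + w) / 2) • (a + b) - ((z - w) / 2) • (b - a) by module, h]
  module

/-- Barycentric criterion for isogonality along the edge `XY` when the opposite edges of
`XYZW` other than `XY`, `ZW` are equal. -/
lemma isogCond_of_barycentric {X Y Z W P Q : Pt} (hXY : X ≠ Y)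
    (h₁ : dist X Z = dist Y W) (h₂ : dist X W = dist Y Z) {x y z w x' y' z' w' : ℝ}
    (hs : x + y + z + w = 1) (hs' : x' + y' + z' + w' = 1)
    (hP : P = x • X + y • Y + z • Z + w • W) (hQ : Q = x' • X + y' • Y + z' • Z + w' • W)
    (hzw : z ≠ 0 ∨ w ≠ 0) (h : z * z' = w * w') : IsogCond X Y Z W P Q := by
  obtain ⟨k, hz', hw'⟩ : ∃ k, z' = k * w ∧ w' = k * z := by
    rcases hzw with hz | hw
    · exact ⟨w' / z, by field_simp; linarith, by field_simp⟩
    · exact ⟨z' / w, by field_simp, by field_simp; linarith⟩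
  have hn : ‖Y - X‖ ^ 2 ≠ 0 := pow_ne_zero _ (norm_ne_zero_iff.2 (sub_ne_zero.2 hXY.symm))
  set i : ℝ := ⟪Y - X, Z - X⟫ / ‖Y - X‖ ^ 2 with hi
  set j : ℝ := ⟪Y - X, W - X⟫ / ‖Y - X‖ ^ 2 with hj
  have hi' : i * ‖Y - X‖ ^ 2 = ⟪Y - X, Z - X⟫ := div_mul_cancel₀ _ hn
  have hj' : j * ‖Y - X‖ ^ 2 = ⟪Y - X, W - X⟫ := div_mul_cancel₀ _ hn
  have ha : ⟪Y - X, Z - X - i • (Y - X)⟫ = 0 := by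
    rw [inner_sub_right, inner_smul_right, real_inner_self_eq_norm_sq, hi', sub_self]
  have hb : ⟪Y - X, W - X - j • (Y - X)⟫ = 0 := by
    rw [inner_sub_right, inner_smul_right, real_inner_self_eq_norm_sq, hj', sub_self]
  have hij : i + j = 1 := by
    rw [hi, hj, ← add_div, div_eq_one_iff_eq hn, ← real_inner_self_eq_norm_sq]
    have e₁ := congrArg (· ^ 2) h₁
    have e₂ := congrArg (· ^ 2) h₂
    simp only [sq_dist_eq_sum] at e₁ e₂
    simp only [inner_eq_sum, PiLp.sub_apply]
    linear_combination (e₁ + e₂) / 2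
  have hab : ‖Z - X - i • (Y - X)‖ = ‖W - X - j • (Y - X)‖ := by
    rw [← sq_eq_sq₀ (norm_nonneg _) (norm_nonneg _), ← real_inner_self_eq_norm_sq,
      ← real_inner_self_eq_norm_sq]
    have e₁ := congrArg (· ^ 2) h₁
    have e₂ := congrArg (· ^ 2) h₂
    have hj1 : j = 1 - i := by linarith
    rw [← real_inner_self_eq_norm_sq] at hi' hj'
    rw [hj1] at hj' ⊢
    simp only [sq_dist_eq_sum] at e₁ e₂
    simp only [inner_eq_sum, PiLp.sub_apply, PiLp.smul_apply, smul_eq_mul] at hi' hj' ⊢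
    linear_combination (e₁ - e₂) / 2 + (hi' - hj') - 2 * (1 - i) * hi' + 2 * i * hj'
  refine ⟨X + (y' + z' * i + w' * j) • (Y - X) + (k * z) • (Z - X - i • (Y - X)) +
    (k * w) • (W - X - j • (Y - X)), ?_, ?_⟩
  · have hX : X ∈ affineSpan ℝ ({X, Y, P} : Set Pt) := subset_affineSpan ℝ _ (by simp)
    have hd : ∀ q ∈ ({X, Y, P} : Set Pt), q - X ∈ (affineSpan ℝ ({X, Y, P} : Set Pt)).direction :=
      fun q hq => AffineSubspace.vsub_mem_direction (subset_affineSpan ℝ _ hq) hX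
    have := AffineSubspace.vadd_mem_of_mem_direction (add_mem
      (Submodule.smul_mem _ (y' + z' * i + w' * j - k * z * i - k * w * j - k * y)
        (hd Y (by simp))) (Submodule.smul_mem _ k (hd P (by simp)))) hX
    rw [vadd_eq_add] at this
    convert SetLike.mem_coe.2 this using 1
    rw [hP, show x = 1 - y - z - w by linarith]
    module
  · rw [edgeReflect_apply_s18 hXY (add_sub_cancel _ _).symm (add_sub_cancel _ _).symm ha hb hab, hQ,
      hz', hw',
      show x' = 1 - y' - k * w - k * z by linarith]
    module

/-- The equation of the circumsphere in barycentric coordinates. -/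
lemma barycentric_sphere {A B C D O P : Pt} {R p q r s : ℝ}
    (hOA : dist O A = R) (hOB : dist O B = R) (hOC : dist O C = R) (hOD : dist O D = R)
    (hP : dist O P = R) (hs : p + q + r + s = 1)
    (hPe : P = p • A + q • B + r • C + s • D) :
    p * q * dist A B ^ 2 + r * s * dist C D ^ 2 + (p * r * dist A C ^ 2 + q * s * dist B D ^ 2)
      + (p * s * dist A D ^ 2 + q * r * dist B C ^ 2) = 0 := by
  have hp : p = 1 - q - r - s := by linarith
  have eA := congrArg (· ^ 2) hOA
  have eB := congrArg (· ^ 2) hOB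
  have eC := congrArg (· ^ 2) hOC
  have eD := congrArg (· ^ 2) hOD
  have eP := congrArg (· ^ 2) hP
  simp only [sq_dist_eq_sum, hPe, PiLp.add_apply, PiLp.smul_apply, smul_eq_mul] at *
  subst hp
  linear_combination (1 - q - r - s) * eA + q * eB + r * eC + s * eD - eP

/-- A point with two vanishing barycentric coordinates that lies on the circumsphere is a
vertex. -/
lemma eq_or_eq_of_mem_sphere {A B O P : Pt} {R p q : ℝ} (hAB : A ≠ B)
    (hOA : dist O A = R) (hOB : dist O B = R) (hP : dist O P = R) (hs : p + q = 1)
    (hPe : P = p • A + q • B) : P = A ∨ P = B := by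
  have h := barycentric_sphere (r := 0) (s := 0) hOA hOB hOA hOA hP (by linarith)
    (show P = p • A + q • B + (0 : ℝ) • A + (0 : ℝ) • A by rw [hPe]; module)
  have h' : p * q = 0 := by
    have : dist A B ^ 2 ≠ 0 := pow_ne_zero _ (dist_ne_zero.2 hAB)
    simpa [this] using h
  rcases mul_eq_zero.1 h' with h0 | h0
  · right; rw [hPe, h0, show q = 1 by linarith]; module
  · left; rw [hPe, h0, show p = 1 by linarith]; module

/-- Existence of barycentric coordinates. -/
lemma exists_barycentric {A B C D : Pt} (h : AffineIndependent ℝ ![A, B, C, D]) (P : Pt) :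
    ∃ p q r s : ℝ, p + q + r + s = 1 ∧ P = p • A + q • B + r • C + s • D := by
  have htop : affineSpan ℝ (Set.range ![A, B, C, D]) = ⊤ := by
    rw [h.affineSpan_eq_top_iff_card_eq_finrank_add_one]
    simp
  obtain ⟨w, hw, hP⟩ := eq_affineCombination_of_mem_affineSpan_of_fintype
    (show P ∈ affineSpan ℝ (Set.range ![A, B, C, D]) by rw [htop]; trivial)
  refine ⟨w 0, w 1, w 2, w 3, by simpa [Fin.sum_univ_four] using hw, ?_⟩
  rw [Finset.affineCombination_eq_linear_combination _ _ _ hw] at hP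
  simpa [Fin.sum_univ_four] using hP

/-- Uniqueness of barycentric coordinates. -/
lemma barycentric_unique {A B C D : Pt} (h : AffineIndependent ℝ ![A, B, C, D])
    {p q r s p' q' r' s' : ℝ} (hs : p + q + r + s = 1) (hs' : p' + q' + r' + s' = 1)
    (he : p • A + q • B + r • C + s • D = p' • A + q' • B + r' • C + s' • D) :
    p = p' ∧ q = q' ∧ r = r' ∧ s = s' := by
  have h1 : ∑ i, ![p, q, r, s] i = 1 := by simpa [Fin.sum_univ_four] using hs
  have h2 : ∑ i, ![p', q', r', s'] i = 1 := by simpa [Fin.sum_univ_four] using hs'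
  have := (affineIndependent_iff_eq_of_fintype_affineCombination_eq ℝ _).1 h _ _ h1 h2 (by
    rw [Finset.affineCombination_eq_linear_combination _ _ _ h1,
      Finset.affineCombination_eq_linear_combination _ _ _ h2]
    simpa [Fin.sum_univ_four] using he)
  exact ⟨congrFun this 0, congrFun this 1, congrFun this 2, congrFun this 3⟩

lemma exists_of_mem_affineSpan_triple {U V W P : Pt}
    (h : P ∈ affineSpan ℝ ({U, V, W} : Set Pt)) :
    ∃ s t : ℝ, P = U + s • (V - U) + t • (W - U) := by
  have hU : U ∈ affineSpan ℝ ({U, V, W} : Set Pt) := subset_affineSpan ℝ _ (by simp)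
  have hd := AffineSubspace.vsub_mem_direction h hU
  rw [direction_affineSpan, vectorSpan_eq_span_vsub_set_right ℝ
    (show U ∈ ({U, V, W} : Set Pt) by simp)] at hd
  simp only [Set.image_insert_eq, Set.image_singleton, vsub_eq_sub, sub_self,
    Submodule.span_insert_zero] at hd
  obtain ⟨s, t, hst⟩ := Submodule.mem_span_pair.1 hd
  exact ⟨s, t, by rw [add_assoc, hst]; abel⟩

/-- The circumcircle of a triangle inscribed in a sphere lies on that sphere. -/
lemma dist_eq_of_mem_circumcircle {O U V W P O' : Pt} {R : ℝ}
    (hU : dist O U = R) (hV : dist O V = R) (hW : dist O W = R)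
    (hV' : dist O' U = dist O' V) (hW' : dist O' U = dist O' W)
    (hP : P ∈ affineSpan ℝ ({U, V, W} : Set Pt)) (hP' : dist O' P = dist O' U) :
    dist O P = R := by
  obtain ⟨s, t, rfl⟩ := exists_of_mem_affineSpan_triple hP
  have hR : 0 ≤ R := hU ▸ dist_nonneg
  rw [← sq_eq_sq₀ dist_nonneg hR]
  have eU := congrArg (· ^ 2) hU
  have eV := congrArg (· ^ 2) hV
  have eW := congrArg (· ^ 2) hW
  have eV' := congrArg (· ^ 2) hV'
  have eW' := congrArg (· ^ 2) hW'
  have eP' := congrArg (· ^ 2) hP'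
  simp only [sq_dist_eq_sum, PiLp.add_apply, PiLp.smul_apply, PiLp.sub_apply, smul_eq_mul] at *
  linear_combination (1 - s - t) * eU + s * eV + t * eW + s * eV' + t * eW' + eP'

/-- In an isosceles tetrahedron, the reflection in the bimedian through the midpoints of `DC`
and `AB` exchanges `A` with `B` and `C` with `D`. -/
lemma lineReflect_barycentric {A B C D : Pt}
    (h₂ : dist B C = dist A D) (h₃ : dist A C = dist B D) {p q r s : ℝ}
    (hs : p + q + r + s = 1) :
    lineReflect (midpoint ℝ D C) (midpoint ℝ A B) (p • A + q • B + r • C + s • D) =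
      q • A + p • B + s • C + r • D := by
  have e₂ := congrArg (· ^ 2) h₂
  have e₃ := congrArg (· ^ 2) h₃
  have hmid : ∀ U V : Pt, midpoint ℝ U V = (1 / 2 : ℝ) • U + (1 / 2 : ℝ) • V := fun U V => by
    rw [midpoint_eq_smul_add, smul_add]; norm_num
  have h := lineReflect_add (U := midpoint ℝ D C) (V := midpoint ℝ A B)
    (p := AffineMap.lineMap (midpoint ℝ D C) (midpoint ℝ A B) (p + q))
    (v := ((p - q) / 2) • (A - B) + ((r - s) / 2) • (C - D))
    (AffineMap.lineMap_mem_affineSpan_pair _ _ _) (by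
      simp only [sq_dist_eq_sum] at e₂ e₃
      simp only [hmid, inner_eq_sum, PiLp.add_apply, PiLp.smul_apply, PiLp.sub_apply, smul_eq_mul]
      linear_combination ((p - q) / 8) * (e₃ - e₂) - ((r - s) / 8) * (e₃ + e₂))
  rw [AffineMap.lineMap_apply, vsub_eq_sub, vadd_eq_add] at h
  rw [show r = 1 - p - q - s by linarith] at h ⊢
  convert h using 1
  · congr 1
    simp only [hmid]
    module
  · simp only [hmid]
    module

/-- Let `ABCD` be an isosceles tetrahedron with circumcenter `O` and circumradius `R`,
let `X` be a point of the circumsphere other than a vertex, and let `X_C ≠ X` be a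
common point of the circumcircle of triangle `XDC` (with circumcenter `O₁`) and the
circumcircle of triangle `XAB` (with circumcenter `O₂`). Then the reflection of `X_C`
in the bimedian `ℓ_C` (the line joining the midpoints of `DC` and `AB`) is an isogonal
conjugate of `X` with respect to `ABCD`. -/
theorem reflection_of_second_intersection_is_isogonal_conjugate
    (A B C D : Pt) (hindep : AffineIndependent ℝ ![A, B, C, D])
    (h₁ : dist A B = dist C D) (h₂ : dist B C = dist A D) (h₃ : dist A C = dist B D)
    (O : Pt) (R : ℝ)
    (hOA : dist O A = R) (hOB : dist O B = R) (hOC : dist O C = R) (hOD : dist O D = R)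
    (X : Pt) (hX : dist O X = R) (hXv : X ∉ ({A, B, C, D} : Set Pt))
    (X_C : Pt) (hne : X_C ≠ X)
    (O₁ : Pt) (hO₁mem : O₁ ∈ affineSpan ℝ ({X, D, C} : Set Pt))
    (hO₁D : dist O₁ X = dist O₁ D) (hO₁C : dist O₁ X = dist O₁ C)
    (hXC₁mem : X_C ∈ affineSpan ℝ ({X, D, C} : Set Pt))
    (hXC₁ : dist O₁ X_C = dist O₁ X)
    (O₂ : Pt) (hO₂mem : O₂ ∈ affineSpan ℝ ({X, A, B} : Set Pt))
    (hO₂A : dist O₂ X = dist O₂ A) (hO₂B : dist O₂ X = dist O₂ B)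
    (hXC₂mem : X_C ∈ affineSpan ℝ ({X, A, B} : Set Pt))
    (hXC₂ : dist O₂ X_C = dist O₂ X) :
    IsIsogonalConjugate A B C D X (lineReflect (midpoint ℝ D C) (midpoint ℝ A B) X_C) := by
  obtain ⟨p, q, r, s, hs, hXe⟩ := exists_barycentric hindep X
  have hinj := hindep.injective
  have hAB : A ≠ B := fun h => absurd (hinj (a₁ := 0) (a₂ := 1) h) (by decide)
  have hAC : A ≠ C := fun h => absurd (hinj (a₁ := 0) (a₂ := 2) h) (by decide)
  have hAD : A ≠ D := fun h => absurd (hinj (a₁ := 0) (a₂ := 3) h) (by decide)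
  have hBC : B ≠ C := fun h => absurd (hinj (a₁ := 1) (a₂ := 2) h) (by decide)
  have hBD : B ≠ D := fun h => absurd (hinj (a₁ := 1) (a₂ := 3) h) (by decide)
  have hCD : C ≠ D := fun h => absurd (hinj (a₁ := 2) (a₂ := 3) h) (by decide)
  simp only [Set.mem_insert_iff, Set.mem_singleton_iff, not_or] at hXv
  obtain ⟨hXA, hXB, hXC, hXD⟩ := hXv
  obtain ⟨d, c, hXCe⟩ := exists_of_mem_affineSpan_triple hXC₁mem
  obtain ⟨a, b, hXCe'⟩ := exists_of_mem_affineSpan_triple hXC₂mem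
  set t := 1 - d - c with ht
  set t' := 1 - a - b with ht'
  have hcoord := barycentric_unique hindep (p := t * p) (q := t * q) (r := t * r + c)
    (s := t * s + d) (p' := t' * p + a) (q' := t' * q + b) (r' := t' * r) (s' := t' * s)
    (by linear_combination t * hs) (by linear_combination t' * hs) (by
      trans X_C
      · rw [hXCe, hXe, ht]; module
      · rw [hXCe', hXe, ht']; module)
  obtain ⟨-, -, hr, hs''⟩ := hcoord
  have hXCb : X_C = (t * p) • A + (t * q) • B + (t' * r) • C + (t' * s) • D := by
    rw [← hr, ← hs'', hXCe, hXe, ht]; module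
  have hsum : t * p + t * q + t' * r + t' * s = 1 := by
    rw [← hr, ← hs'']; linear_combination t * hs
  have hXCO : dist O X_C = R :=
    dist_eq_of_mem_circumcircle hX hOD hOC hO₁D hO₁C hXC₁mem hXC₁
  have hS := barycentric_sphere hOA hOB hOC hOD hX hs hXe
  have hS' := barycentric_sphere hOA hOB hOC hOD hXCO hsum hXCb
  have hkey : t * (p * q) = t' * (r * s) := by
    rw [← h₁, h₂, h₃] at hS hS'
    have hprod : dist A B ^ 2 * ((t - t') * (t * (p * q) - t' * (r * s))) = 0 := by
      linear_combination hS' - t * t' * hS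
    rcases mul_eq_zero.1 hprod with h | h
    · exact absurd h (pow_ne_zero _ (dist_ne_zero.2 hAB))
    rcases mul_eq_zero.1 h with h | h
    · refine absurd ?_ hne
      have htt : t' = t := by linarith
      have ht1 : t = 1 := by rw [htt] at hsum; linear_combination hsum - t * hs
      rw [hXCb, hXe, htt, ht1]; module
    · linarith
  rw [hXCb, lineReflect_barycentric h₂ h₃ hsum]
  have hsum' : t * q + t * p + t' * s + t' * r = 1 := by linarith
  have hne_zero : ∀ {U V : Pt} {x y z w : ℝ}, U ≠ V → dist O U = R → dist O V = R → X ≠ U →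
      X ≠ V → x + y + z + w = 1 → (z = 0 → w = 0 → X = x • U + y • V) → z ≠ 0 ∨ w ≠ 0 := by
    intro U V x y z w hUV hU hV hXU hXV hsum hXUV
    by_contra! hzw
    rcases eq_or_eq_of_mem_sphere hUV hU hV hX (by linarith [hzw.1, hzw.2]) (hXUV hzw.1 hzw.2)
      with h | h
    exacts [hXU h, hXV h]
  refine ⟨?_, ?_, ?_, ?_, ?_, ?_⟩
  · refine isogCond_of_barycentric hAB h₃ h₂.symm (x := p) (y := q) (z := r) (w := s)
      (x' := t * q) (y' := t * p) (z' := t' * s) (w' := t' * r) (by linarith) (by linarith)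
      (by rw [hXe]) (by rfl)
      (hne_zero hAB hOA hOB hXA hXB hs ?_) (by ring)
    rintro rfl rfl; rw [hXe]; module
  · refine isogCond_of_barycentric hAC (by rw [h₁]) (by rw [← h₂, dist_comm]) (x := p) (y := r)
      (z := q) (w := s) (x' := t * q) (y' := t' * s) (z' := t * p) (w' := t' * r) (by linarith)
      (by linarith) (by rw [hXe]; module) (by module)
      (hne_zero (x := p) (y := r) hAC hOA hOC hXA hXC (by linarith) ?_) (by linear_combination hkey)
    rintro rfl rfl; rw [hXe]; module
  · refine isogCond_of_barycentric hAD (by rw [h₁, dist_comm]) (by rw [h₃, dist_comm]) (x := p)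
      (y := s) (z := q) (w := r) (x' := t * q) (y' := t' * r) (z' := t * p) (w' := t' * s)
      (by linarith) (by linarith) (by rw [hXe]; module) (by module)
      (hne_zero (x := p) (y := s) hAD hOA hOD hXA hXD (by linarith) ?_) (by linear_combination hkey)
    rintro rfl rfl; rw [hXe]; module
  · refine isogCond_of_barycentric hBC (by rw [← h₁, dist_comm]) (by rw [← h₃, dist_comm]) (x := q)
      (y := r) (z := p) (w := s) (x' := t * p) (y' := t' * s) (z' := t * q) (w' := t' * r)
      (by linarith) (by linarith) (by rw [hXe]; module) (by module)
      (hne_zero (x := q) (y := r) hBC hOB hOC hXB hXC (by linarith) ?_) (by linear_combination hkey)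
    rintro rfl rfl; rw [hXe]; module
  · refine isogCond_of_barycentric hBD (by rw [dist_comm, h₁, dist_comm])
      (by rw [h₂, dist_comm]) (x := q)
      (y := s) (z := p) (w := r) (x' := t * p) (y' := t' * r) (z' := t * q) (w' := t' * s)
      (by linarith) (by linarith) (by rw [hXe]; module) (by module)
      (hne_zero (x := q) (y := s) hBD hOB hOD hXB hXD (by linarith) ?_) (by linear_combination hkey)
    rintro rfl rfl; rw [hXe]; module
  · refine isogCond_of_barycentric hCD (by rw [dist_comm, h₃, dist_comm])
      (by rw [dist_comm, h₂, dist_comm]) (x := r)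
      (y := s) (z := p) (w := q) (x' := t' * s) (y' := t' * r) (z' := t * q) (w' := t * p)
      (by linarith) (by linarith) (by rw [hXe]; module) (by module)
      (hne_zero (x := r) (y := s) hCD hOC hOD hXC hXD (by linarith) ?_) (by ring)
    rintro rfl rfl; rw [hXe]; module


end
end
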